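/- arXiv:math/9910027 — 3 statements merged into one kernel-verified Lean document; each statement's English description precedes it below -/
import Mathlib

section
/- Let E be an inner product space over ℂ with two differentials d, d^c, formal adjoints δ, δ^c, the commutation relations d ∘ d^c + d^c ∘ d = 0 and d ∘ δ^c + δ^c ∘ d = 0, equal Laplacians, and Hodge decompositions for both (d, δ) and (d^c, δ^c). Let H := (ker d) ⊓ (ker δ). Then the kernel of d^c decomposes as the internal direct sum ker d^c = H ⊕ range (d ∘ d^c) ⊕ range (δ ∘ d^c): these three submodules are independent and their supremum is ker d^c. -/
open scoped ComplexInnerProductSpace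

/-- `E` admits a Hodge decomposition for `(d, δ)`: the harmonic subspace
`H := ker d ⊓ ker δ`, the range of `d` and the range of `δ` are independent
submodules whose supremum is all of `E`. -/
def HodgeDecomposition {E : Type*} [NormedAddCommGroup E] [InnerProductSpace ℂ E]
    (d δ : E →ₗ[ℂ] E) : Prop :=
  iSupIndep ![LinearMap.ker d ⊓ LinearMap.ker δ, LinearMap.range d, LinearMap.range δ] ∧
    (LinearMap.ker d ⊓ LinearMap.ker δ) ⊔ LinearMap.range d ⊔ LinearMap.range δ = ⊤

section Adjoint

variable {E : Type*} [NormedAddCommGroup E] [InnerProductSpace ℂ E] {d δ dc δc : E →ₗ[ℂ] E}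

theorem inner_adjoint_left (hadj : ∀ x y : E, ⟪d x, y⟫ = ⟪x, δ y⟫) (x y : E) :
    ⟪δ x, y⟫ = ⟪x, d y⟫ := by
  rw [← inner_conj_symm, ← hadj, inner_conj_symm]

theorem adjoint_eq_zero_of_apply_adjoint_eq_zero (hadj : ∀ x y : E, ⟪d x, y⟫ = ⟪x, δ y⟫)
    {x : E} (h : d (δ x) = 0) : δ x = 0 := by
  rw [← inner_self_eq_zero (𝕜 := ℂ), ← hadj, h, inner_zero_left]

/-- An element is harmonic if and only if the Laplacian kills it. -/
theorem ker_inf_ker_eq_ker_laplacian (hadj : ∀ x y : E, ⟪d x, y⟫ = ⟪x, δ y⟫) :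
    LinearMap.ker d ⊓ LinearMap.ker δ = LinearMap.ker (d ∘ₗ δ + δ ∘ₗ d) := by
  ext x
  simp only [Submodule.mem_inf, LinearMap.mem_ker, LinearMap.add_apply, LinearMap.comp_apply]
  refine ⟨fun ⟨h₁, h₂⟩ ↦ by simp [h₁, h₂], fun h ↦ ?_⟩
  have hsum : ⟪δ x, δ x⟫ + ⟪d x, d x⟫ = 0 := by
    rw [← hadj, ← inner_adjoint_left hadj, ← inner_add_left, h, inner_zero_left]
  have hre : ‖δ x‖ ^ 2 + ‖d x‖ ^ 2 = 0 := by
    simpa only [map_add, inner_self_eq_norm_sq, map_zero] using congrArg RCLike.re hsum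
  obtain ⟨h₁, h₂⟩ := (add_eq_zero_iff_of_nonneg (sq_nonneg _) (sq_nonneg _)).mp hre
  exact ⟨by simpa using h₂, by simpa using h₁⟩

/-- The adjoint of the relation `d ∘ δc + δc ∘ d = 0`. -/
theorem apply_adjoint_eq_neg (hadj : ∀ x y : E, ⟪d x, y⟫ = ⟪x, δ y⟫)
    (hadjc : ∀ x y : E, ⟪dc x, y⟫ = ⟪x, δc y⟫) (hcomm : d ∘ₗ δc + δc ∘ₗ d = 0) (x : E) :
    dc (δ x) = -δ (dc x) := by
  refine ext_inner_left ℂ fun y ↦ ?_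
  have h : d (δc y) + δc (d y) = 0 := LinearMap.congr_fun hcomm y
  rw [inner_neg_right, ← hadj, ← inner_adjoint_left hadjc, ← inner_adjoint_left hadjc, ← hadj,
    ← inner_neg_left, eq_neg_of_add_eq_zero_left h]

end Adjoint

/-- Under the assumptions of the formality theorem, the kernel of `dc`
decomposes as the internal direct sum
`ker dc = H ⊕ range (d ∘ dc) ⊕ range (δ ∘ dc)`, where `H := ker d ⊓ ker δ`. -/
theorem ker_dc_threefold_decomposition
    {E : Type*} [NormedAddCommGroup E] [InnerProductSpace ℂ E]
    (d δ dc δc : E →ₗ[ℂ] E)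
    (hd : d ∘ₗ d = 0) (hdc : dc ∘ₗ dc = 0)
    (hadj : ∀ x y : E, ⟪d x, y⟫ = ⟪x, δ y⟫)
    (hadjc : ∀ x y : E, ⟪dc x, y⟫ = ⟪x, δc y⟫)
    (hcomm₁ : d ∘ₗ dc + dc ∘ₗ d = 0)
    (hcomm₂ : d ∘ₗ δc + δc ∘ₗ d = 0)
    (hlap : d ∘ₗ δ + δ ∘ₗ d = dc ∘ₗ δc + δc ∘ₗ dc)
    (hHodge : HodgeDecomposition d δ) (hHodgec : HodgeDecomposition dc δc) :
    iSupIndep ![LinearMap.ker d ⊓ LinearMap.ker δ, LinearMap.range (d ∘ₗ dc),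
        LinearMap.range (δ ∘ₗ dc)] ∧
      (LinearMap.ker d ⊓ LinearMap.ker δ) ⊔ LinearMap.range (d ∘ₗ dc) ⊔
        LinearMap.range (δ ∘ₗ dc) = LinearMap.ker dc := by
  have hH : LinearMap.ker d ⊓ LinearMap.ker δ = LinearMap.ker dc ⊓ LinearMap.ker δc := by
    rw [ker_inf_ker_eq_ker_laplacian hadj, ker_inf_ker_eq_ker_laplacian hadjc, hlap]
  have hdcδ := apply_adjoint_eq_neg hadj hadjc hcomm₂
  have hdcd (x : E) : dc (d x) = -d (dc x) :=
    eq_neg_of_add_eq_zero_right (LinearMap.congr_fun hcomm₁ x)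
  have hdcdc (x : E) : dc (dc x) = 0 := LinearMap.congr_fun hdc x
  refine ⟨hHodge.1.mono fun i ↦ ?_, le_antisymm (sup_le (sup_le ?_ ?_) ?_) fun x hx ↦ ?_⟩
  · fin_cases i
    · exact le_rfl
    · exact LinearMap.range_comp_le_range dc d
    · exact LinearMap.range_comp_le_range dc δ
  · exact hH.trans_le inf_le_left
  · rintro _ ⟨x, rfl⟩
    simp [hdcd, hdcdc]
  · rintro _ ⟨x, rfl⟩
    simp [hdcδ, hdcdc]
  · have hxc : x ∈ LinearMap.ker dc ⊓ LinearMap.ker δc ⊔ LinearMap.range dc ⊔ LinearMap.range δc :=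
      hHodgec.2 ▸ Submodule.mem_top
    obtain ⟨_, hy, _, ⟨b, rfl⟩, rfl⟩ := Submodule.mem_sup.mp hxc
    obtain ⟨h, hh, _, ⟨a, rfl⟩, rfl⟩ := Submodule.mem_sup.mp hy
    have hb : δc b = 0 := by
      refine adjoint_eq_zero_of_apply_adjoint_eq_zero hadjc ?_
      have hh₁ : dc h = 0 := hh.1
      simpa [hh₁, hdcdc] using hx
    have ha : a ∈ LinearMap.ker d ⊓ LinearMap.ker δ ⊔ LinearMap.range d ⊔ LinearMap.range δ :=
      hHodge.2 ▸ Submodule.mem_top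
    obtain ⟨_, hz, _, ⟨v, rfl⟩, rfl⟩ := Submodule.mem_sup.mp ha
    obtain ⟨k, hk, _, ⟨u, rfl⟩, rfl⟩ := Submodule.mem_sup.mp hz
    have hk₁ : dc k = 0 := (hH ▸ hk).1
    rw [hb, add_zero, map_add, map_add, hk₁, zero_add, hdcd, hdcδ, ← add_assoc]
    exact Submodule.add_mem_sup (Submodule.add_mem_sup (hH ▸ hh) (neg_mem ⟨u, rfl⟩))
      (neg_mem ⟨v, rfl⟩)
end

section
/- Let E be an inner product space over ℂ with two differentials d, d^c, formal adjoints δ, δ^c, the commutation relations d ∘ d^c + d^c ∘ d = 0 and d ∘ δ^c + δ^c ∘ d = 0, equal Laplacians, and Hodge decompositions for both (d, δ) and (d^c, δ^c). Then the inclusion of ker d^c into E is surjective on d-cohomology: for every x ∈ E with d x = 0 there exists y ∈ E with d y = 0, d^c y = 0, and x - y ∈ range d. -/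
open scoped ComplexInnerProductSpace

/-- An operator `d` with formal adjoint `δ` vanishes on `δ y` only if `δ y = 0`. -/
theorem formalAdjoint_apply_eq_zero {E : Type*} [NormedAddCommGroup E] [InnerProductSpace ℂ E]
    {d δ : E →ₗ[ℂ] E} (hadj : ∀ x y : E, inner ℂ (d x) y = inner ℂ x (δ y))
    {y : E} (h : d (δ y) = 0) : δ y = 0 := by
  rw [← inner_self_eq_zero (𝕜 := ℂ), ← hadj, h, inner_zero_left]

/-- Elements of the kernel of the Laplacian `d δ + δ d` are `d`-closed. -/
theorem apply_eq_zero_of_laplacian_apply_eq_zero {E : Type*} [NormedAddCommGroup E]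
    [InnerProductSpace ℂ E] {d δ : E →ₗ[ℂ] E}
    (hadj : ∀ x y : E, inner ℂ (d x) y = inner ℂ x (δ y))
    {x : E} (h : d (δ x) + δ (d x) = 0) : d x = 0 := by
  have hsum : inner ℂ (δ x) (δ x) + inner ℂ (d x) (d x) = 0 := by
    have hd : inner ℂ x (d (δ x)) = inner ℂ (δ x) (δ x) := by
      rw [← inner_conj_symm, hadj, inner_conj_symm]
    rw [← hd, hadj, ← inner_add_right, h, inner_zero_right]
  have hnorm : ‖δ x‖ ^ 2 + ‖d x‖ ^ 2 = 0 := by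
    rw [← inner_self_eq_norm_sq (𝕜 := ℂ), ← inner_self_eq_norm_sq (𝕜 := ℂ), ← map_add, hsum,
      map_zero]
  rw [← norm_eq_zero, ← sq_eq_zero_iff]
  nlinarith [sq_nonneg ‖δ x‖, sq_nonneg ‖d x‖]

/-- Under the assumptions of the formality theorem, the inclusion of
`ker dc` into `E` is surjective on `d`-cohomology: every `d`-closed `x` differs from
some element of `ker d ⊓ ker dc` by a `d`-exact element. -/
theorem inclusion_surjective_on_d_cohomology
    {E : Type*} [NormedAddCommGroup E] [InnerProductSpace ℂ E]
    (d δ dc δc : E →ₗ[ℂ] E)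
    (hd : d ∘ₗ d = 0) (hdc : dc ∘ₗ dc = 0)
    (hadj : ∀ x y : E, ⟪d x, y⟫ = ⟪x, δ y⟫)
    (hadjc : ∀ x y : E, ⟪dc x, y⟫ = ⟪x, δc y⟫)
    (hcomm₁ : d ∘ₗ dc + dc ∘ₗ d = 0)
    (hcomm₂ : d ∘ₗ δc + δc ∘ₗ d = 0)
    (hlap : d ∘ₗ δ + δ ∘ₗ d = dc ∘ₗ δc + δc ∘ₗ dc)
    (hHodge : HodgeDecomposition d δ) (hHodgec : HodgeDecomposition dc δc) :
    ∀ x : E, d x = 0 → ∃ y : E, d y = 0 ∧ dc y = 0 ∧ x - y ∈ LinearMap.range d := by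
  intro x hx
  have hmem : x ∈ (LinearMap.ker d ⊓ LinearMap.ker δ) ⊔ LinearMap.range d ⊔ LinearMap.range δ :=
    hHodge.2 ▸ Submodule.mem_top
  obtain ⟨w, hw, _, ⟨b, rfl⟩, rfl⟩ := Submodule.mem_sup.1 hmem
  obtain ⟨h, ⟨hdh, hδh⟩, _, ⟨a, rfl⟩, rfl⟩ := Submodule.mem_sup.1 hw
  have hdh : d h = 0 := hdh
  have hδh : δ h = 0 := hδh
  have hda : d (d a) = 0 := LinearMap.congr_fun hd a
  have hb : δ b = 0 := formalAdjoint_apply_eq_zero hadj (by simpa [hdh, hda] using hx)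
  have hΔ : dc (δc h) + δc (dc h) = 0 := by
    simpa [hdh, hδh] using (LinearMap.congr_fun hlap h).symm
  exact ⟨h, hdh, apply_eq_zero_of_laplacian_apply_eq_zero hadjc hΔ, a, by simp [hb]⟩
end

section
/- Let E be an inner product space over ℂ with two differentials d, d^c, formal adjoints δ, δ^c, the commutation relations d ∘ d^c + d^c ∘ d = 0 and d ∘ δ^c + δ^c ∘ d = 0, equal Laplacians, and Hodge decompositions for both (d, δ) and (d^c, δ^c). Then the d d^c-lemma holds: for every x ∈ E with d x = 0, if x ∈ range d^c then x ∈ range (d ∘ d^c), i.e., x = d (d^c a) for some a ∈ E. -/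
open scoped ComplexInnerProductSpace

/-- An element annihilated by the Laplacian of `d` is `d`-closed. -/
theorem apply_eq_zero_of_laplacian_eq_zero
    {E : Type*} [NormedAddCommGroup E] [InnerProductSpace ℂ E] {d δ : E →ₗ[ℂ] E}
    (hadj : ∀ x y : E, ⟪d x, y⟫ = ⟪x, δ y⟫) {h : E} (hh : d (δ h) + δ (d h) = 0) :
    d h = 0 := by
  have hre : RCLike.re ⟪h, d (δ h) + δ (d h)⟫ = ‖δ h‖ ^ 2 + ‖d h‖ ^ 2 := by
    rw [inner_add_right, map_add, inner_re_symm h (d (δ h)), hadj, ← hadj h,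
      inner_self_eq_norm_sq, inner_self_eq_norm_sq]
  rw [hh, inner_zero_right, map_zero] at hre
  rw [← norm_eq_zero, ← sq_eq_zero_iff]
  nlinarith [sq_nonneg ‖δ h‖, sq_nonneg ‖d h‖]

/-- If `d` anticommutes with the adjoint of `dc`, then every `d`-closed element of
the range of `dc ∘ δ` vanishes. -/
theorem apply_adjoint_eq_zero
    {E : Type*} [NormedAddCommGroup E] [InnerProductSpace ℂ E] {d δ dc δc : E →ₗ[ℂ] E}
    (hadj : ∀ x y : E, ⟪d x, y⟫ = ⟪x, δ y⟫)
    (hadjc : ∀ x y : E, ⟪dc x, y⟫ = ⟪x, δc y⟫)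
    (hcomm : d ∘ₗ δc + δc ∘ₗ d = 0) {v : E} (hv : d (dc (δ v)) = 0) :
    dc (δ v) = 0 := by
  have hz : d (δc (dc (δ v))) = 0 := by
    simpa [hv] using LinearMap.congr_fun hcomm (dc (δ v))
  rw [← inner_self_eq_zero (𝕜 := ℂ), hadjc, inner_eq_zero_symm, ← hadj, hz, inner_zero_left]

/-- Under the assumptions of the formality theorem, the `d dc`-lemma
holds: every `d`-closed element of `range dc` lies in `range (d ∘ dc)`, i.e.
`x = d (dc a)` for some `a`. -/
theorem ddc_lemma
    {E : Type*} [NormedAddCommGroup E] [InnerProductSpace ℂ E]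
    (d δ dc δc : E →ₗ[ℂ] E)
    (hd : d ∘ₗ d = 0) (hdc : dc ∘ₗ dc = 0)
    (hadj : ∀ x y : E, ⟪d x, y⟫ = ⟪x, δ y⟫)
    (hadjc : ∀ x y : E, ⟪dc x, y⟫ = ⟪x, δc y⟫)
    (hcomm₁ : d ∘ₗ dc + dc ∘ₗ d = 0)
    (hcomm₂ : d ∘ₗ δc + δc ∘ₗ d = 0)
    (hlap : d ∘ₗ δ + δ ∘ₗ d = dc ∘ₗ δc + δc ∘ₗ dc)
    (hHodge : HodgeDecomposition d δ) (hHodgec : HodgeDecomposition dc δc) :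
    ∀ x : E, d x = 0 → x ∈ LinearMap.range dc → ∃ a : E, x = d (dc a) := by
  intro x hx ⟨y, hy⟩
  have hyT : y ∈ (LinearMap.ker d ⊓ LinearMap.ker δ) ⊔ LinearMap.range d ⊔ LinearMap.range δ :=
    hHodge.2 ▸ Submodule.mem_top
  obtain ⟨p, hp, _, ⟨v, rfl⟩, hpv⟩ := Submodule.mem_sup.1 hyT
  obtain ⟨h, ⟨hdh, hδh⟩, _, ⟨u, rfl⟩, rfl⟩ := Submodule.mem_sup.1 hp
  have hdch : dc h = 0 := apply_eq_zero_of_laplacian_eq_zero hadjc <| by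
    have := LinearMap.congr_fun hlap h
    simpa [LinearMap.mem_ker.1 hdh, LinearMap.mem_ker.1 hδh] using this.symm
  have hdcd : d (dc u) + dc (d u) = 0 := LinearMap.congr_fun hcomm₁ u
  have hxu : x = dc (δ v) - d (dc u) := by
    rw [← hy, ← hpv, map_add, map_add, hdch, eq_neg_of_add_eq_zero_right hdcd]
    abel
  have hdw : d (dc (δ v)) = 0 := by
    have hdd : d (d (dc u)) = 0 := LinearMap.congr_fun hd (dc u)
    rw [hxu, map_sub, hdd, sub_zero] at hx
    exact hx
  have hw : dc (δ v) = 0 := apply_adjoint_eq_zero hadj hadjc hcomm₂ hdw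
  exact ⟨-u, by rw [hxu, hw, map_neg, map_neg, zero_sub]⟩
end
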